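/- arXiv:1412.5657 — 4 statements merged into one kernel-verified Lean document; each statement's English description precedes it below -/
import Mathlib

section
/- For every odd positive integer ℓ, there exist a real number μ > 0 and a real-valued random variable u such that (1) u is supported on at most ℓ nonnegative real values, and (2) E[u^k] = E[N(μ,1)^k] for all k = 1, …, ℓ, where N(μ,1) denotes a Gaussian random variable with mean μ and variance 1. -/
open MeasureTheory ProbabilityTheory

open Polynomial in
/-- Gauss quadrature for an abstract positive definite functional on real polynomials. -/
theorem quad_aux (E : ℝ[X] →ₗ[ℝ] ℝ) (hnn : ∀ p, 0 ≤ E (p * p)) (hdef : ∀ p, E (p * p) = 0 → p = 0)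
    (n : ℕ) (hn : 0 < n) : ∃ w x : Fin n → ℝ, (∀ i, 0 ≤ w i) ∧
      ∀ k, k + 1 ≤ 2 * n → ∑ i, w i * x i ^ k = E (X ^ k) := by
  let V := degreeLT ℝ n
  let core : InnerProductSpace.Core ℝ V :=
    { inner := fun p q => E ((p : ℝ[X]) * (q : ℝ[X]))
      conj_inner_symm := fun p q => by simp [mul_comm]
      re_inner_nonneg := fun p => by simpa using hnn p
      add_left := fun p q r => by simp [add_mul]
      smul_left := fun p q r => by simp
      definite := fun p hp => Subtype.ext (hdef p hp) }
  let _ : NormedAddCommGroup V := core.toNormedAddCommGroup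
  let _ : InnerProductSpace ℝ V := InnerProductSpace.ofCore core.toCore
  have hin : ∀ p q : V, inner ℝ p q = E ((p : ℝ[X]) * (q : ℝ[X])) := fun p q => rfl
  have : FiniteDimensional ℝ V := LinearEquiv.finiteDimensional (degreeLTEquiv ℝ n).symm
  have hfr : Module.finrank ℝ V = n := by
    rw [LinearEquiv.finrank_eq (degreeLTEquiv ℝ n)]; simp
  let b := stdOrthonormalBasis ℝ V
  let A : V →ₗ[ℝ] V :=
    { toFun := fun q => ∑ i, E (X * ((b i : V) : ℝ[X]) * (q : ℝ[X])) • b i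
      map_add' := fun p q => by simp [mul_add, add_smul, Finset.sum_add_distrib]
      map_smul' := fun c q => by simp [Finset.smul_sum, smul_smul] }
  have hA : ∀ r q : V, inner ℝ r (A q) = E (X * (r : ℝ[X]) * (q : ℝ[X])) := by
    intro r q
    have h1 : inner ℝ r (A q) = ∑ i, E (X * ((b i : V) : ℝ[X]) * (q : ℝ[X])) * inner ℝ r (b i) := by
      simp only [A, LinearMap.coe_mk, AddHom.coe_mk, inner_sum, inner_smul_right]
    rw [h1]
    conv_rhs => rw [← b.sum_repr' r]
    simp only [Submodule.coe_sum, Submodule.coe_smul, Finset.mul_sum, Finset.sum_mul, map_sum,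
      mul_smul_comm, smul_mul_assoc, map_smul, smul_eq_mul]
    refine Finset.sum_congr rfl fun i _ => ?_
    rw [mul_comm, real_inner_comm]
  have hsym : A.IsSymmetric := by
    intro p q
    rw [real_inner_comm, hA, hA]
    congr 1; ring
  let m : ℕ → V := fun k => if h : k < n then ⟨X ^ k, by
    rw [mem_degreeLT]; simpa using h⟩ else 0
  have hm : ∀ k, k < n → ((m k : V) : ℝ[X]) = X ^ k := fun k h => by simp [m, h]
  have hAm : ∀ k, k < n → (A ^ k) (m 0) = m k := by
    intro k
    induction k with
    | zero => intro _; simp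
    | succ k ih =>
      intro h
      rw [pow_succ', Module.End.mul_apply, ih (by omega)]
      refine ext_inner_left ℝ fun r => ?_
      rw [hA, hin, hm _ h, hm _ (by omega)]
      congr 1; ring
  have hpow : ∀ a : ℕ, ∀ p q : V, inner ℝ p ((A ^ a) q) = inner ℝ ((A ^ a) p) q :=
    fun a p q => ((hsym.pow a) p q).symm
  have hmom : ∀ k, k + 1 ≤ 2 * n → inner ℝ (m 0) ((A ^ k) (m 0)) = E (X ^ k) := by
    intro k hk
    by_cases h : k < n
    · rw [hAm k h, hin, hm _ hn, hm _ h]; simp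
    · obtain ⟨c, rfl⟩ : ∃ c, k = (n - 1) + (c + 1) := ⟨k - n, by omega⟩
      rw [pow_add, Module.End.mul_apply, hpow, hAm _ (by omega), pow_succ', Module.End.mul_apply,
        hAm _ (by omega), hA, hm _ (by omega), hm _ (by omega)]
      congr 1; ring
  let e := hsym.eigenvectorBasis hfr
  refine ⟨fun i => (inner ℝ (e i) (m 0)) ^ 2, fun i => hsym.eigenvalues hfr i,
    fun i => sq_nonneg _, fun k hk => ?_⟩
  rw [← hmom k hk]
  have hev : ∀ k i, (A ^ k) (e i) = (hsym.eigenvalues hfr i) ^ k • e i := by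
    intro k i
    induction k with
    | zero => simp
    | succ k ih =>
      rw [pow_succ, Module.End.mul_apply]
      have := hsym.apply_eigenvectorBasis hfr i
      simp only [RCLike.ofReal_real_eq_id, id] at this
      rw [show A (e i) = _ from this, map_smul, ih, smul_smul, pow_succ, mul_comm]
  rw [← e.sum_inner_mul_inner (m 0) ((A ^ k) (m 0))]
  refine Finset.sum_congr rfl fun i _ => ?_
  rw [hpow, hev, inner_smul_left, real_inner_comm (e i) (m 0)]
  simp; ring

theorem gauss_int (p : Polynomial ℝ) : Integrable (fun x => p.eval x) (gaussianReal 0 1) := by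
  induction p using Polynomial.induction_on' with
  | add p q hp hq => simp only [Polynomial.eval_add]; exact hp.add hq
  | monomial k a =>
    simp only [Polynomial.eval_monomial]
    refine Integrable.const_mul ?_ a
    have h := (memLp_id_gaussianReal (μ := 0) (v := 1) k).integrable_norm_pow'
    refine h.mono' (by fun_prop) (Filter.Eventually.of_forall fun x => ?_)
    simp

/-- For every odd positive integer ℓ, there exist μ > 0 and a real random variable `u`
(formalized via its distribution, a probability measure `ν` on ℝ) such that `u` is supported
on at most ℓ nonnegative real values and its k-th moments match those of N(μ,1) for
k = 1, …, ℓ. -/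
theorem stmt0 (ℓ : ℕ) (hpos : 0 < ℓ) (hodd : Odd ℓ) :
    ∃ μ : ℝ, 0 < μ ∧
      ∃ ν : Measure ℝ, IsProbabilityMeasure ν ∧
        (∃ s : Finset ℝ, s.card ≤ ℓ ∧ (∀ x ∈ s, 0 ≤ x) ∧ ν ↑s = 1) ∧
        (∀ k : ℕ, 1 ≤ k → k ≤ ℓ →
          ∫ x, x ^ k ∂ν = ∫ x, x ^ k ∂(gaussianReal μ 1)) := by
  obtain ⟨d, rfl⟩ := hodd
  let E : Polynomial ℝ →ₗ[ℝ] ℝ :=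
    { toFun := fun p => ∫ x, p.eval x ∂(gaussianReal 0 1)
      map_add' := fun p q => by
        simp only [Polynomial.eval_add]
        exact integral_add (gauss_int p) (gauss_int q)
      map_smul' := fun c p => by simp [integral_const_mul] }
  have hE : ∀ p, E p = ∫ x, p.eval x ∂(gaussianReal 0 1) := fun p => rfl
  have hnn : ∀ p, 0 ≤ E (p * p) := fun p => by
    rw [hE]; refine integral_nonneg fun x => ?_
    simpa using mul_self_nonneg _
  have hdef : ∀ p, E (p * p) = 0 → p = 0 := by
    intro p hp
    by_contra hne
    rw [hE, integral_eq_zero_iff_of_nonneg (fun x => by simpa using mul_self_nonneg _)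
      (gauss_int _)] at hp
    have : NullSingletonClass (gaussianReal 0 1) := nullSingletonClass_gaussianReal (by simp)
    have h0 : (gaussianReal 0 1) {x | p.IsRoot x} = 0 :=
      (Polynomial.finite_setOfPred_isRoot hne).measure_zero _
    have h1 : ∀ᵐ x ∂(gaussianReal 0 1), ¬ p.IsRoot x := by
      rw [ae_iff]; simpa using h0
    obtain ⟨x, hx, hx'⟩ := (hp.and h1).exists
    apply hx'
    simpa using hx
  obtain ⟨w, x, hw, hq⟩ := quad_aux E hnn hdef (d + 1) (by omega)
  have hpoly : ∀ p : Polynomial ℝ, p.natDegree ≤ 2 * d + 1 → ∑ i, w i * p.eval (x i) = E p := by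
    intro p hp
    conv_rhs => rw [p.as_sum_range' (2 * d + 2) (by omega)]
    simp only [Polynomial.eval_eq_sum_range' (show p.natDegree < 2 * d + 2 by omega),
      Finset.mul_sum, map_sum]
    rw [Finset.sum_comm]
    refine Finset.sum_congr rfl fun k hk => ?_
    rw [← Polynomial.C_mul_X_pow_eq_monomial, ← Polynomial.smul_eq_C_mul, map_smul,
      ← hq k (by have := Finset.mem_range.1 hk; omega), smul_eq_mul, Finset.mul_sum]
    exact Finset.sum_congr rfl fun i _ => by ring
  have hsum : ∑ i, w i = 1 := by
    have := hq 0 (by omega)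
    simpa [hE] using this
  let μ : ℝ := 1 + ∑ i, |x i|
  have hμ : 0 < μ := by positivity
  have hx : ∀ i, 0 ≤ x i + μ := by
    intro i
    have h1 := Finset.single_le_sum (f := fun i => |x i|) (fun i _ => abs_nonneg _)
      (Finset.mem_univ i)
    have h2 := neg_abs_le (x i)
    simp only [μ] at *
    linarith
  have htot : ∑ i, ENNReal.ofReal (w i) = 1 := by
    rw [← ENNReal.ofReal_sum_of_nonneg (fun i _ => hw i), hsum, ENNReal.ofReal_one]
  refine ⟨μ, hμ, Measure.sum fun i => ENNReal.ofReal (w i) • Measure.dirac (x i + μ),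
    ⟨?_⟩, ⟨Finset.univ.image fun i => x i + μ, ?_, ?_, ?_⟩, ?_⟩
  · simpa using htot
  · refine Finset.card_image_le.trans ?_
    simp; omega
  · simpa using hx
  · rw [Measure.sum_apply _ (Finset.measurableSet _)]
    simpa using htot
  · intro k _ hk
    have hmap : gaussianReal μ 1 = (gaussianReal 0 1).map (· + μ) := by
      rw [gaussianReal_map_add_const]; simp
    have h := hpoly ((Polynomial.X + Polynomial.C μ) ^ k) (by
      rw [Polynomial.natDegree_pow]; simpa using hk)
    rw [hE] at h
    simp only [Polynomial.eval_pow, Polynomial.eval_add, Polynomial.eval_X, Polynomial.eval_C] at h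
    rw [hmap, integral_map (by fun_prop) (by fun_prop), ← h, Measure.sum_fintype,
      integral_finsetSum_measure (fun i _ =>
        (integrable_dirac (by simp)).smul_measure ENNReal.ofReal_ne_top)]
    refine Finset.sum_congr rfl fun i _ => ?_
    rw [integral_smul_measure, integral_dirac, ENNReal.toReal_ofReal (hw i), smul_eq_mul]
end

section
/- For every real number μ > 0 and every positive integer ℓ, there exists a real-valued random variable v such that (1) v is supported on at most ℓ+1 real values and P[v < 0] > 0, and (2) E[v^k] = E[N(μ,1)^k] for all k = 1, …, ℓ, where N(μ,1) denotes a Gaussian random variable with mean μ and variance 1. -/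
open MeasureTheory ProbabilityTheory

/-- The moment curve `x ↦ (x, x^2, …, x^ℓ)`. -/
noncomputable def momCurve (ℓ : ℕ) (x : ℝ) : Fin ℓ → ℝ := fun i => x ^ ((i : ℕ) + 1)

lemma coeff_zero_of_const {ℓ : ℕ} (c : Fin ℓ → ℝ) (K : ℝ)
    (h : ∀ x : ℝ, ∑ i, c i * x ^ ((i : ℕ) + 1) = K) (j : Fin ℓ) : c j = 0 := by
  have hP : (∑ i : Fin ℓ, Polynomial.C (c i) * Polynomial.X ^ ((i : ℕ) + 1) : Polynomial ℝ)
      = Polynomial.C K := by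
    apply Polynomial.funext
    intro x
    simp [Polynomial.eval_finsetSum, h x]
  have h2 := congrArg (fun p => Polynomial.coeff p ((j : ℕ) + 1)) hP
  simp only [Polynomial.finsetSum_coeff, Polynomial.coeff_C_mul, Polynomial.coeff_X_pow,
    Polynomial.coeff_C] at h2
  rw [Finset.sum_eq_single j] at h2
  · simpa using h2
  · intro b _ hb
    have : (j : ℕ) + 1 ≠ (b : ℕ) + 1 := by
      intro h'; apply hb; ext; omega
    rw [if_neg this, mul_zero]
  · simp

lemma lin_eq_sum {ℓ : ℕ} (f : (Fin ℓ → ℝ) →ₗ[ℝ] ℝ) (v : Fin ℓ → ℝ) :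
    f v = ∑ i, f (Pi.single i 1) * v i := by
  rw [LinearMap.pi_apply_eq_sum_univ f v]
  refine Finset.sum_congr rfl fun i _ => ?_
  rw [smul_eq_mul, mul_comm]
  congr 2
  ext j
  simp [Pi.single_apply, eq_comm]

lemma lin_zero_of_const {ℓ : ℕ} (f : (Fin ℓ → ℝ) →ₗ[ℝ] ℝ) (K : ℝ)
    (h : ∀ x : ℝ, f (momCurve ℓ x) = K) : f = 0 := by
  have h0 := coeff_zero_of_const (fun i => f (Pi.single i 1)) K (fun x => by
    rw [← h x, lin_eq_sum f (momCurve ℓ x)]; rfl)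
  ext v
  simpa using h0 v

lemma hull_interior_nonempty (ℓ : ℕ) :
    (interior (convexHull ℝ (Set.range (momCurve ℓ)))).Nonempty := by
  rw [interior_convexHull_nonempty_iff_affineSpan_eq_top]
  have hz : (0 : Fin ℓ → ℝ) ∈ Set.range (momCurve ℓ) := ⟨0, by ext i; simp [momCurve]⟩
  have hsp : Submodule.span ℝ (Set.range (momCurve ℓ)) = ⊤ := by
    by_contra hne
    obtain ⟨f, hf0, hf⟩ := Submodule.exists_le_ker_of_lt_top _ (lt_top_iff_ne_top.2 hne)
    exact hf0 (lin_zero_of_const f 0 fun x => hf (Submodule.subset_span ⟨x, rfl⟩))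
  rw [AffineSubspace.affineSpan_eq_top_iff_vectorSpan_eq_top_of_nonempty ℝ _ _ ⟨0, hz⟩,
    vectorSpan_eq_span_vsub_set_right ℝ hz]
  simpa using hsp

noncomputable def gMom (μ : ℝ) (ℓ : ℕ) : Fin ℓ → ℝ :=
  fun i => ∫ x, x ^ ((i : ℕ) + 1) ∂(gaussianReal μ 1)

lemma integrable_pow_gauss (μ : ℝ) (n : ℕ) :
    Integrable (fun x : ℝ => x ^ n) (gaussianReal μ 1) :=
  integrable_pow_of_mem_interior_integrableExpSet (X := fun x : ℝ => x)
    (by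
      have := integrableExpSet_id_gaussianReal (μ := μ) (v := 1)
      change 0 ∈ interior (integrableExpSet id (gaussianReal μ 1))
      simp) n

lemma gMom_mem_interior (μ : ℝ) (ℓ : ℕ) :
    gMom μ ℓ ∈ interior (convexHull ℝ (Set.range (momCurve ℓ))) := by
  by_contra hm
  have hc := convex_convexHull ℝ (Set.range (momCurve ℓ))
  have hne := hull_interior_nonempty ℓ
  obtain ⟨f, hf⟩ := geometric_hahn_banach_open_point hc.interior isOpen_interior hm
  have hle : ∀ a ∈ convexHull ℝ (Set.range (momCurve ℓ)), f a ≤ f (gMom μ ℓ) := by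
    intro a ha
    have h1 : a ∈ closure (interior (convexHull ℝ (Set.range (momCurve ℓ)))) := by
      rw [hc.closure_interior_eq_closure_of_nonempty_interior hne]
      exact subset_closure ha
    have h2 : IsClosed {a | f a ≤ f (gMom μ ℓ)} := isClosed_le f.continuous continuous_const
    exact closure_minimal (fun b hb => (hf b hb).le) h2 h1
  set g : ℝ → ℝ := fun x => f (gMom μ ℓ) - f (momCurve ℓ x) with hg
  have hgn : ∀ x, 0 ≤ g x := fun x =>
    sub_nonneg.2 (hle _ (subset_convexHull _ _ ⟨x, rfl⟩))
  have hfs : ∀ v : Fin ℓ → ℝ, f v = ∑ i, f (Pi.single i 1) * v i :=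
    fun v => lin_eq_sum f.toLinearMap v
  have hfi : Integrable (fun x => f (momCurve ℓ x)) (gaussianReal μ 1) := by
    simp_rw [hfs (momCurve ℓ _)]
    exact integrable_finsetSum _ fun i _ => (integrable_pow_gauss μ _).const_mul _
  have hfint : ∫ x, f (momCurve ℓ x) ∂(gaussianReal μ 1) = f (gMom μ ℓ) := by
    simp_rw [hfs (momCurve ℓ _)]
    rw [integral_finsetSum _ fun i _ => show Integrable (fun x => f (Pi.single i 1) * momCurve ℓ x i) _ from
      (integrable_pow_gauss μ _).const_mul _, hfs (gMom μ ℓ)]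
    refine Finset.sum_congr rfl fun i _ => ?_
    rw [integral_const_mul]; rfl
  have hgi : Integrable g (gaussianReal μ 1) := (integrable_const _).sub hfi
  have hg0 : ∫ x, g x ∂(gaussianReal μ 1) = 0 := by
    rw [hg, integral_sub (integrable_const _) hfi, hfint]; simp
  rw [integral_eq_zero_iff_of_nonneg hgn hgi] at hg0
  have hg1 : g =ᵐ[volume] 0 :=
    (gaussianReal_absolutelyContinuous' μ one_ne_zero).ae_le hg0
  have hgc : Continuous g := by
    have : Continuous (momCurve ℓ) := by unfold momCurve; fun_prop
    fun_prop
  have hg2 : g = 0 := (hgc.ae_eq_iff_eq volume continuous_zero).1 hg1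
  have hf0 : f.toLinearMap = 0 := lin_zero_of_const _ (f (gMom μ ℓ)) fun x => by
    have := congrFun hg2 x
    simp only [hg, Pi.zero_apply] at this
    change f (momCurve ℓ x) = _
    linarith
  obtain ⟨a, ha⟩ := hne
  have h3 := hf a ha
  have h4 : ∀ v, f v = 0 := fun v => LinearMap.congr_fun hf0 v
  rw [h4, h4] at h3
  exact lt_irrefl _ h3

/-- `m` is the moment vector of a probability weight on a set of `n` reals charging `-1`. -/
def MomRep {ℓ : ℕ} (m : Fin ℓ → ℝ) (n : ℕ) : Prop :=
  ∃ (s : Finset ℝ) (w : ℝ → ℝ), s.card = n ∧ -1 ∈ s ∧ 0 < w (-1) ∧ (∀ x ∈ s, 0 ≤ w x) ∧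
    ∑ x ∈ s, w x = 1 ∧ ∑ x ∈ s, w x • momCurve ℓ x = m

lemma exists_rep (μ : ℝ) (ℓ : ℕ) : ∃ n, MomRep (gMom μ ℓ) n := by
  classical
  set m := gMom μ ℓ with hm
  have hcont : Continuous fun e : ℝ => m + e • (m - momCurve ℓ (-1)) := by fun_prop
  have hnhds : ∀ᶠ e in nhds (0 : ℝ), m + e • (m - momCurve ℓ (-1)) ∈
      interior (convexHull ℝ (Set.range (momCurve ℓ))) := by
    apply hcont.continuousAt.eventually_mem
    apply isOpen_interior.mem_nhds
    simpa using gMom_mem_interior μ ℓ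
  obtain ⟨e, hemem, he⟩ := ((hnhds.filter_mono nhdsWithin_le_nhds).and
    (self_mem_nhdsWithin (s := Set.Ioi (0 : ℝ)))).exists
  have he : 0 < e := he
  have h1 := interior_subset hemem
  rw [convexHull_eq] at h1
  obtain ⟨ι, t, w, z, hw, hw1, hz, hcm⟩ := h1
  rw [Finset.centerMass_eq_of_sum_1 _ _ hw1] at hcm
  have hz' : ∀ i, ∃ a : ℝ, i ∈ t → momCurve ℓ a = z i := by
    intro i
    by_cases hi : i ∈ t
    · obtain ⟨a, ha⟩ := hz i hi
      exact ⟨a, fun _ => ha⟩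
    · exact ⟨0, fun h => absurd h hi⟩
  choose a ha using hz'
  set s : Finset ℝ := insert (-1) (t.image a) with hs
  set u : ℝ → ℝ := fun x => ∑ i ∈ t with a i = x, w i with hu
  have hmaps : ∀ i ∈ t, a i ∈ s := fun i hi =>
    Finset.mem_insert_of_mem (Finset.mem_image_of_mem a hi)
  have hu0 : ∀ x, 0 ≤ u x := fun x =>
    Finset.sum_nonneg fun i hi => hw i (Finset.mem_filter.1 hi).1
  have hu1 : ∑ x ∈ s, u x = 1 := by
    rw [← hw1]; exact Finset.sum_fiberwise_of_maps_to hmaps w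
  have hum : ∑ x ∈ s, u x • momCurve ℓ x = m + e • (m - momCurve ℓ (-1)) := by
    rw [← hcm, ← Finset.sum_fiberwise_of_maps_to hmaps]
    refine Finset.sum_congr rfl fun x _ => ?_
    rw [hu, Finset.sum_smul]
    refine Finset.sum_congr rfl fun i hi => ?_
    obtain ⟨hi1, hi2⟩ := Finset.mem_filter.1 hi
    rw [← ha i hi1, hi2]
  have hs1 : (-1 : ℝ) ∈ s := Finset.mem_insert_self _ _
  have hpos : (0 : ℝ) < 1 + e := by linarith
  refine ⟨s.card, s, fun x => (1 + e)⁻¹ * (u x + if x = -1 then e else 0), rfl, hs1, ?_, ?_, ?_, ?_⟩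
  · have := hu0 (-1)
    simp only [if_true]
    positivity
  · intro x _
    have := hu0 x
    have : 0 ≤ (if x = -1 then e else 0) := by split_ifs <;> linarith
    positivity
  · rw [← Finset.mul_sum, Finset.sum_add_distrib, hu1, Finset.sum_ite_eq' s (-1 : ℝ), if_pos hs1]
    field_simp
  · simp_rw [mul_smul, add_smul]
    rw [← Finset.smul_sum, Finset.sum_add_distrib, hum]
    simp_rw [ite_smul, zero_smul]
    rw [Finset.sum_ite_eq' s (-1 : ℝ), if_pos hs1]
    have : m + e • (m - momCurve ℓ (-1)) + e • momCurve ℓ (-1) = (1 + e) • m := by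
      module
    rw [this, smul_smul, inv_mul_cancel₀ hpos.ne', one_smul]

lemma rep_step {ℓ : ℕ} (hℓ : 0 < ℓ) (m : Fin ℓ → ℝ) (n : ℕ) (hn : ℓ + 1 < n) (h : MomRep m n) :
    MomRep m (n - 1) := by
  classical
  obtain ⟨s, w, hcard, hs1, hw1, hw, hsum, hmom⟩ := h
  have hinj : Function.Injective (momCurve ℓ) := by
    intro x y hxy
    have := congrFun hxy ⟨0, hℓ⟩
    simpa [momCurve] using this
  have hc2 : Module.finrank ℝ (Fin ℓ → ℝ) + 1 < (s.image (momCurve ℓ)).card := by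
    rw [Finset.card_image_of_injective _ hinj, hcard]; simpa using hn
  obtain ⟨F, hF1, hF2, y, hy, hFy⟩ :=
    Module.exists_nontrivial_relation_sum_zero_of_finrank_succ_lt_card (R := ℝ) hc2
  rw [Finset.sum_image (fun _ _ _ _ h => hinj h)] at hF1 hF2
  obtain ⟨x, hx, rfl⟩ := Finset.mem_image.1 hy
  have key : ∃ f : ℝ → ℝ, ∑ x ∈ s, f x • momCurve ℓ x = 0 ∧ ∑ x ∈ s, f x = 0 ∧
      (∃ x ∈ s, f x ≠ 0) ∧ f (-1) ≤ 0 := by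
    rcases le_total (F (momCurve ℓ (-1))) 0 with h | h
    · exact ⟨fun x => F (momCurve ℓ x), hF1, hF2, ⟨x, hx, hFy⟩, h⟩
    · refine ⟨fun x => - F (momCurve ℓ x), ?_, ?_, ⟨x, hx, neg_ne_zero.2 hFy⟩, by simpa using h⟩
      · simp_rw [neg_smul]; rw [Finset.sum_neg_distrib, hF1, neg_zero]
      · rw [Finset.sum_neg_distrib, hF2, neg_zero]
  obtain ⟨f, hf1, hf2, hf3, hf4⟩ := key
  obtain ⟨p, hp, hfp⟩ := Finset.exists_pos_of_sum_zero_of_exists_nonzero f hf2 hf3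
  obtain ⟨q, hq, hqmin⟩ := Finset.exists_min_image (s.filter fun x => 0 < f x)
    (fun x => w x / f x) ⟨p, Finset.mem_filter.2 ⟨hp, hfp⟩⟩
  obtain ⟨hqs, hfq⟩ := Finset.mem_filter.1 hq
  set r := w q / f q with hr
  have hr0 : 0 ≤ r := div_nonneg (hw q hqs) hfq.le
  have hq1 : (-1 : ℝ) ≠ q := by
    rintro rfl; linarith
  have hwq : w q - r * f q = 0 := by rw [hr]; field_simp; ring
  refine ⟨s.erase q, fun x => w x - r * f x, ?_, Finset.mem_erase.2 ⟨hq1, hs1⟩, ?_, ?_, ?_, ?_⟩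
  · rw [Finset.card_erase_of_mem hqs, hcard]
  · have := mul_nonpos_of_nonneg_of_nonpos hr0 hf4
    simp only
    linarith
  · intro x hx
    have hxs := Finset.mem_of_mem_erase hx
    rcases lt_or_ge 0 (f x) with h | h
    · have h1 := hqmin x (Finset.mem_filter.2 ⟨hxs, h⟩)
      rw [le_div_iff₀ h] at h1
      simp only
      linarith
    · have := mul_nonpos_of_nonneg_of_nonpos hr0 h
      have := hw x hxs
      simp only
      linarith
  · rw [Finset.sum_erase s (f := fun x => w x - r * f x) hwq, Finset.sum_sub_distrib,
      ← Finset.mul_sum, hf2, hsum]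
    simp
  · rw [Finset.sum_erase s (f := fun x => (w x - r * f x) • momCurve ℓ x)
      (by simp only [hwq, zero_smul])]
    simp_rw [sub_smul, mul_smul]
    rw [Finset.sum_sub_distrib, ← Finset.smul_sum, hf1, hmom]
    simp

lemma exists_small_rep (μ : ℝ) {ℓ : ℕ} (hℓ : 0 < ℓ) : ∃ n ≤ ℓ + 1, MomRep (gMom μ ℓ) n := by
  classical
  have h := exists_rep μ ℓ
  refine ⟨Nat.find h, ?_, Nat.find_spec h⟩
  by_contra hlt
  push Not at hlt
  exact Nat.find_min h (m := Nat.find h - 1) (by omega)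
    (rep_step hℓ _ _ hlt (Nat.find_spec h))

/-- For every μ > 0 and positive integer ℓ, there exists a real random variable `v`
(formalized via its distribution, a probability measure `ν` on ℝ) supported on at most
ℓ+1 real values, taking negative values with positive probability, whose k-th moments
match those of N(μ,1) for k = 1, …, ℓ. -/
theorem stmt1 (μ : ℝ) (hμ : 0 < μ) (ℓ : ℕ) (hpos : 0 < ℓ) :
    ∃ ν : Measure ℝ, IsProbabilityMeasure ν ∧
      (∃ s : Finset ℝ, s.card ≤ ℓ + 1 ∧ ν ↑s = 1) ∧
      0 < ν {x | x < 0} ∧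
      (∀ k : ℕ, 1 ≤ k → k ≤ ℓ →
        ∫ x, x ^ k ∂ν = ∫ x, x ^ k ∂(gaussianReal μ 1)) := by
  obtain ⟨n, hn, s, w, hcard, hs1, hw1, hw, hsum, hmom⟩ := exists_small_rep μ hpos
  have hone : ∑ x ∈ s, ENNReal.ofReal (w x) = 1 := by
    rw [← ENNReal.ofReal_sum_of_nonneg hw, hsum, ENNReal.ofReal_one]
  refine ⟨∑ x ∈ s, ENNReal.ofReal (w x) • Measure.dirac x, ⟨?_⟩, ⟨s, by omega, ?_⟩, ?_, ?_⟩
  · simpa [Measure.finsetSum_apply] using hone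
  · rw [Measure.finsetSum_apply, ← hone]
    refine Finset.sum_congr rfl fun x hx => ?_
    simp [hx]
  · rw [Measure.finsetSum_apply]
    refine lt_of_lt_of_le ?_ (Finset.single_le_sum
      (f := fun x => (ENNReal.ofReal (w x) • Measure.dirac x) {x : ℝ | x < 0})
      (fun _ _ => zero_le) hs1)
    simpa using hw1
  · intro k hk1 hk2
    rw [integral_finsetSum_measure]
    · have h := congrFun hmom ⟨k - 1, by omega⟩
      have hk : k - 1 + 1 = k := by omega
      simp only [gMom, momCurve, Finset.sum_apply, Pi.smul_apply, smul_eq_mul, hk] at h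
      rw [← h]
      refine Finset.sum_congr rfl fun x hx => ?_
      rw [integral_smul_measure, integral_dirac, ENNReal.toReal_ofReal (hw x hx), smul_eq_mul]
    · intro x hx
      exact (integrable_dirac (by simp)).smul_measure ENNReal.ofReal_ne_top
end

section
/- For every ε > 0 there exists an infinitely differentiable function Φ_ε : ℝ → [0,1] such that (1) Φ_ε(x) = 0 for all x < 0; (2) Φ_ε(x) = 1 for all x > ε; and (3) for every integer k ≥ 1 and every x ∈ ℝ, |Φ_ε^{(k)}(x)| ≤ α(k) · (1/ε)^k, where Φ_ε^{(k)} denotes the k-th derivative and α(k) := 2e · 64^k · k! · k^{2k+2}. -/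
/-- The derivative-bound function α(k) = 2e · 64^k · k! · k^{2k+2}. -/
noncomputable def mollifierBound (k : ℕ) : ℝ :=
  2 * Real.exp 1 * 64 ^ k * (Nat.factorial k : ℝ) * (k : ℝ) ^ (2 * k + 2)

open Polynomial in
theorem aux_hm_deriv (m : ℕ) :
    deriv (fun x : ℝ => x⁻¹ ^ m * expNegInvGlue x) =
      fun x => x⁻¹ ^ (m + 2) * expNegInvGlue x - (m : ℝ) * (x⁻¹ ^ (m + 1) * expNegInvGlue x) := by
  funext x
  have h := (expNegInvGlue.hasDerivAt_polynomial_eval_inv_mul (X ^ m) x).deriv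
  simp only [eval_pow, eval_X] at h
  rw [h]
  cases m with
  | zero => simp
  | succ m => simp; ring

open Polynomial in
theorem aux_hm_contDiff (m : ℕ) (n : ℕ∞) :
    ContDiff ℝ n (fun x : ℝ => x⁻¹ ^ m * expNegInvGlue x) := by
  simpa using expNegInvGlue.contDiff_polynomial_eval_inv_mul (n := n) (X ^ m)

theorem aux_hm_bound (m : ℕ) (x : ℝ) :
    |x⁻¹ ^ m * expNegInvGlue x| ≤ (m.factorial : ℝ) := by
  rcases le_or_gt x 0 with hx | hx
  · simp [expNegInvGlue.zero_of_nonpos hx]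
  · have h := Real.pow_div_factorial_le_exp _ (inv_pos.2 hx).le m
    have hf : (0 : ℝ) < m.factorial := by positivity
    rw [div_le_iff₀ hf] at h
    have he : expNegInvGlue x = (Real.exp x⁻¹)⁻¹ := by
      simp [expNegInvGlue, hx.not_ge, Real.exp_neg]
    rw [abs_of_nonneg (mul_nonneg (by positivity) (expNegInvGlue.nonneg x)), he,
      ← div_eq_mul_inv, div_le_iff₀ (Real.exp_pos _), mul_comm]
    linarith

theorem aux_iter_bound (n : ℕ) : ∀ (m : ℕ) (x : ℝ),
    |iteratedDeriv n (fun x : ℝ => x⁻¹ ^ m * expNegInvGlue x) x| ≤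
      (∏ j ∈ Finset.range n, ((m : ℝ) + 2 * j + 1)) * ((m + 2 * n).factorial : ℝ) := by
  induction n with
  | zero => intro m x; simpa using aux_hm_bound m x
  | succ n ih =>
    intro m x
    rw [iteratedDeriv_succ', aux_hm_deriv,
      iteratedDeriv_fun_sub (aux_hm_contDiff (m + 2) n).contDiffAt
        (contDiff_const.mul (aux_hm_contDiff (m + 1) n)).contDiffAt,
      iteratedDeriv_const_mul_field]
    have h1 := ih (m + 2) x
    have h2 := ih (m + 1) x
    set P := ∏ j ∈ Finset.range n, (((m + 2 : ℕ) : ℝ) + 2 * j + 1) with hP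
    have hQ : ∏ j ∈ Finset.range n, (((m + 1 : ℕ) : ℝ) + 2 * j + 1) ≤ P := by
      apply Finset.prod_le_prod
      · intros; positivity
      · intros; push_cast; linarith
    have hF : ((m + 1 + 2 * n).factorial : ℝ) ≤ ((m + 2 * (n + 1)).factorial : ℝ) := by
      exact_mod_cast Nat.factorial_le (by omega)
    have hP0 : 0 ≤ P := Finset.prod_nonneg (by intros; positivity)
    have h2' := h2.trans (mul_le_mul hQ hF (by positivity) hP0)
    have e1 : m + 2 + 2 * n = m + 2 * (n + 1) := by ring
    rw [e1] at h1
    have e2 : ∏ j ∈ Finset.range (n + 1), ((m : ℝ) + 2 * j + 1) = P * (m + 1) := by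
      rw [Finset.prod_range_succ', hP]
      congr 1
      · apply Finset.prod_congr rfl
        intros; push_cast; ring
      · simp
    rw [e2]
    refine (abs_sub _ _).trans ?_
    rw [abs_mul, Nat.abs_cast]
    have := mul_le_mul_of_nonneg_left h2' (Nat.cast_nonneg (α := ℝ) m)
    nlinarith

theorem aux_g_bound (n N : ℕ) (h : n ≤ N) (x : ℝ) :
    |iteratedDeriv n expNegInvGlue x| ≤ 8 ^ n * (n.factorial : ℝ) * (N : ℝ) ^ (2 * n) := by
  have h0 := aux_iter_bound n 0 x
  simp only [pow_zero, one_mul, zero_add, Nat.cast_zero] at h0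
  refine h0.trans ?_
  have h1 : ∏ j ∈ Finset.range n, (2 * (j : ℝ) + 1) ≤ 2 ^ n * (n.factorial : ℝ) := by
    clear h0 h
    induction n with
    | zero => simp
    | succ n ih =>
      rw [Finset.prod_range_succ, Nat.factorial_succ]
      have := mul_le_mul ih (show 2 * (n : ℝ) + 1 ≤ 2 * (n + 1) by linarith) (by positivity)
        (by positivity)
      refine this.trans (le_of_eq ?_)
      push_cast; ring
  have h2 : ((2 * n).factorial : ℝ) ≤ 4 ^ n * (N : ℝ) ^ (2 * n) := by
    have a : ((2 * n).factorial : ℝ) ≤ ((2 * n : ℕ) : ℝ) ^ (2 * n) := by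
      exact_mod_cast Nat.factorial_le_pow (2 * n)
    have b : ((2 * n : ℕ) : ℝ) ^ (2 * n) ≤ (2 * (N : ℝ)) ^ (2 * n) := by
      apply pow_le_pow_left₀ (by positivity)
      push_cast
      have : (n : ℝ) ≤ N := by exact_mod_cast h
      linarith
    refine (a.trans b).trans (le_of_eq ?_)
    rw [mul_pow, pow_mul]; norm_num
  refine (mul_le_mul h1 h2 (by positivity) (by positivity)).trans (le_of_eq ?_)
  rw [show (8 : ℝ) = 2 * 4 by norm_num, mul_pow]; ring

/-- the bump function -/
noncomputable def auxPsi (x : ℝ) : ℝ := expNegInvGlue x * expNegInvGlue (1 - x)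

theorem auxPsi_contDiff (n : ℕ∞) : ContDiff ℝ n auxPsi :=
  expNegInvGlue.contDiff.mul (expNegInvGlue.contDiff.comp (contDiff_const.sub contDiff_id))

theorem auxPsi_bound (n : ℕ) (x : ℝ) :
    |iteratedDeriv n auxPsi x| ≤ 8 ^ n * ((n + 1).factorial : ℝ) * (n : ℝ) ^ (2 * n) := by
  have e : auxPsi = fun x => expNegInvGlue x * expNegInvGlue (1 - x) := rfl
  have c2 : ContDiff ℝ (n : ℕ∞) (fun x : ℝ => expNegInvGlue (1 - x)) :=
    expNegInvGlue.contDiff.comp (contDiff_const.sub contDiff_id)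
  rw [e, iteratedDeriv_fun_mul (expNegInvGlue.contDiff (n := n)).contDiffAt c2.contDiffAt]
  refine (Finset.abs_sum_le_sum_abs _ _).trans ?_
  have key : ∀ i ∈ Finset.range (n + 1),
      |(n.choose i : ℝ) * iteratedDeriv i expNegInvGlue x *
        iteratedDeriv (n - i) (fun x : ℝ => expNegInvGlue (1 - x)) x| ≤
      8 ^ n * (n.factorial : ℝ) * (n : ℝ) ^ (2 * n) := by
    intro i hi
    have hi' : i ≤ n := by simpa [Nat.lt_succ_iff] using hi
    have a := aux_g_bound i n hi' x
    have b := aux_g_bound (n - i) n (Nat.sub_le _ _) (1 - x)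
    rw [iteratedDeriv_comp_const_sub]
    simp only [smul_eq_mul, abs_mul, abs_pow, abs_neg, abs_one, one_pow, one_mul, Nat.abs_cast]
    have := mul_le_mul (mul_le_mul_of_nonneg_left a (Nat.cast_nonneg (α := ℝ) (n.choose i))) b
      (abs_nonneg _) (by positivity)
    refine this.trans (le_of_eq ?_)
    have hc : (n.choose i : ℝ) * i.factorial * (n - i).factorial = n.factorial := by
      exact_mod_cast Nat.choose_mul_factorial_mul_factorial hi'
    rw [← hc]
    obtain ⟨j, rfl⟩ := Nat.exists_eq_add_of_le hi'
    rw [Nat.add_sub_cancel_left]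
    ring
  refine (Finset.sum_le_sum key).trans (le_of_eq ?_)
  rw [Finset.sum_const, Finset.card_range, Nat.factorial_succ, nsmul_eq_mul]
  push_cast; ring

theorem auxPsi_nonneg (x : ℝ) : 0 ≤ auxPsi x :=
  mul_nonneg (expNegInvGlue.nonneg _) (expNegInvGlue.nonneg _)

theorem auxPsi_cont : Continuous auxPsi := (auxPsi_contDiff 0).continuous

/-- the primitive of the bump function -/
noncomputable def auxF (x : ℝ) : ℝ := ∫ t in (0 : ℝ)..x, auxPsi t

theorem auxF_hasDerivAt (x : ℝ) : HasDerivAt auxF (auxPsi x) x :=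
  intervalIntegral.integral_hasDerivAt_right (auxPsi_cont.intervalIntegrable _ _)
    (auxPsi_cont.stronglyMeasurableAtFilter _ _) auxPsi_cont.continuousAt

theorem auxF_deriv : deriv auxF = auxPsi := funext fun x => (auxF_hasDerivAt x).deriv

theorem auxF_contDiff : ContDiff ℝ (⊤ : ℕ∞) auxF := by
  rw [contDiff_infty_iff_deriv, auxF_deriv]
  exact ⟨fun x => (auxF_hasDerivAt x).differentiableAt, auxPsi_contDiff ⊤⟩

theorem auxF_mono : Monotone auxF :=
  monotone_of_deriv_nonneg (fun x => (auxF_hasDerivAt x).differentiableAt)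
    (fun x => by rw [auxF_deriv]; exact auxPsi_nonneg x)

theorem auxF_zero : auxF 0 = 0 := by simp [auxF]

theorem auxF_nonpos (x : ℝ) (hx : x ≤ 0) : auxF x = 0 := by
  unfold auxF
  apply intervalIntegral.integral_zero_ae
  refine Filter.Eventually.of_forall fun t ht => ?_
  rw [Set.uIoc_of_ge hx] at ht
  simp [auxPsi, expNegInvGlue.zero_of_nonpos ht.2]

theorem auxF_sub (a b : ℝ) : auxF b - auxF a = ∫ t in a..b, auxPsi t :=
  intervalIntegral.integral_interval_sub_left (auxPsi_cont.intervalIntegrable _ _)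
    (auxPsi_cont.intervalIntegrable _ _)

theorem auxF_one_le (x : ℝ) (hx : 1 ≤ x) : auxF x = auxF 1 := by
  rw [← sub_eq_zero, auxF_sub]
  apply intervalIntegral.integral_zero_ae
  refine Filter.Eventually.of_forall fun t ht => ?_
  rw [Set.uIoc_of_le hx] at ht
  simp [auxPsi, expNegInvGlue.zero_of_nonpos (show 1 - t ≤ 0 by linarith [ht.1])]

theorem auxF_one : 1 ≤ auxF 1 * (128 * Real.exp 1) := by
  have h1 : auxF (7/10) - auxF (3/10) ≤ auxF 1 := by
    have := auxF_mono (show (7/10 : ℝ) ≤ 1 by norm_num)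
    have := auxF_mono (show (0 : ℝ) ≤ 3/10 by norm_num)
    rw [auxF_zero] at this
    linarith
  have h2 : (4/10 : ℝ) * Real.exp (-(100/21)) ≤ auxF (7/10) - auxF (3/10) := by
    rw [auxF_sub]
    have := intervalIntegral.integral_mono_on (μ := MeasureTheory.volume)
      (a := (3/10 : ℝ)) (b := 7/10)
      (f := fun _ => Real.exp (-(100/21))) (g := auxPsi) (by norm_num)
      (continuous_const.intervalIntegrable _ _) (auxPsi_cont.intervalIntegrable _ _) ?_
    · rw [intervalIntegral.integral_const, smul_eq_mul] at this
      norm_num at this ⊢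
      linarith
    · intro t ht
      have t0 : 0 < t := by linarith [ht.1]
      have t1 : 0 < 1 - t := by linarith [ht.2]
      simp only [auxPsi, expNegInvGlue, t0.not_ge, t1.not_ge, if_false]
      rw [← Real.exp_add, Real.exp_le_exp]
      have : t⁻¹ + (1 - t)⁻¹ = 1 / (t * (1 - t)) := by field_simp; ring
      have h3 : 1 / (t * (1 - t)) ≤ 100 / 21 := by
        rw [div_le_div_iff₀ (by positivity) (by norm_num)]
        nlinarith [mul_nonneg (sub_nonneg.2 ht.1) (sub_nonneg.2 ht.2)]
      linarith
  have h3 : Real.exp (100/21) ≤ 256/5 * Real.exp 1 := by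
    have a : Real.exp (79/21) ≤ 256/5 := by
      have b : Real.exp (79/21) ≤ Real.exp (19/5) := Real.exp_le_exp.2 (by norm_num)
      refine b.trans ?_
      refine le_of_pow_le_pow_left₀ (n := 5) (by norm_num) (by norm_num) ?_
      have : Real.exp (19/5) ^ 5 = Real.exp 1 ^ 19 := by
        rw [← Real.exp_nat_mul, ← Real.exp_nat_mul]; norm_num
      rw [this]
      refine (pow_le_pow_left₀ (Real.exp_pos _).le Real.exp_one_lt_d9.le 19).trans ?_
      norm_num
    have e : Real.exp (100/21) = Real.exp (79/21) * Real.exp 1 := by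
      rw [← Real.exp_add]; norm_num
    rw [e]
    exact mul_le_mul_of_nonneg_right a (Real.exp_pos _).le
  rw [Real.exp_neg] at h2
  have h4 := h2.trans h1
  have h5 : 1 ≤ (Real.exp (100/21))⁻¹ * (256/5 * Real.exp 1) := by
    have h6 := mul_le_mul_of_nonneg_left h3 (inv_nonneg.2 (Real.exp_pos (100/21)).le)
    rwa [inv_mul_cancel₀ (Real.exp_pos (100/21)).ne'] at h6
  nlinarith [Real.exp_pos 1]

/-- For every ε > 0 there is a C^∞ function Φ_ε : ℝ → [0,1] with Φ_ε = 0 on (−∞,0),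
Φ_ε = 1 on (ε,∞), and |Φ_ε^{(k)}(x)| ≤ α(k) · (1/ε)^k for all k ≥ 1 and x ∈ ℝ. -/
theorem stmt10 (ε : ℝ) (hε : 0 < ε) :
    ∃ Φ : ℝ → ℝ, ContDiff ℝ (⊤ : ℕ∞) Φ ∧ (∀ x, Φ x ∈ Set.Icc (0 : ℝ) 1) ∧
      (∀ x : ℝ, x < 0 → Φ x = 0) ∧
      (∀ x : ℝ, ε < x → Φ x = 1) ∧
      (∀ k : ℕ, 1 ≤ k → ∀ x : ℝ, |iteratedDeriv k Φ x| ≤ mollifierBound k * (1 / ε) ^ k) := by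
  have hC1 := auxF_one
  have hC : 0 < auxF 1 := by
    by_contra h
    have : auxF 1 * (128 * Real.exp 1) ≤ 0 :=
      mul_nonpos_of_nonpos_of_nonneg (not_lt.1 h) (by positivity)
    linarith
  have hCinv : (auxF 1)⁻¹ ≤ 128 * Real.exp 1 := by
    rw [inv_le_iff_one_le_mul₀ hC]
    linarith
  refine ⟨fun x => (auxF 1)⁻¹ * auxF (ε⁻¹ * x), ?_, ?_, ?_, ?_, ?_⟩
  · exact contDiff_const.mul (auxF_contDiff.comp (contDiff_const.mul contDiff_id))
  · intro x
    have h0 : 0 ≤ auxF (ε⁻¹ * x) := by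
      rcases le_total (ε⁻¹ * x) 0 with h | h
      · rw [auxF_nonpos _ h]
      · rw [← auxF_zero]; exact auxF_mono h
    have h1 : auxF (ε⁻¹ * x) ≤ auxF 1 := by
      rcases le_total 1 (ε⁻¹ * x) with h | h
      · rw [auxF_one_le _ h]
      · exact auxF_mono h
    refine ⟨by positivity, ?_⟩
    rw [inv_mul_le_iff₀ hC]; linarith
  · intro x hx
    have : ε⁻¹ * x ≤ 0 := mul_nonpos_of_nonneg_of_nonpos (by positivity) hx.le
    simp [auxF_nonpos _ this]
  · intro x hx
    have : 1 ≤ ε⁻¹ * x := by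
      rw [← inv_mul_cancel₀ hε.ne']
      exact mul_le_mul_of_nonneg_left hx.le (by positivity)
    simp only [auxF_one_le _ this]
    exact inv_mul_cancel₀ hC.ne'
  · intro k hk x
    obtain ⟨n, rfl⟩ := Nat.exists_eq_add_of_le' hk
    rw [iteratedDeriv_const_mul_field,
      iteratedDeriv_comp_const_mul (auxF_contDiff.of_le (by exact_mod_cast le_top)),
      iteratedDeriv_succ', auxF_deriv, abs_mul, abs_mul, abs_of_pos (inv_pos.2 hC), abs_pow,
      abs_of_pos (inv_pos.2 hε), one_div, mul_left_comm, mul_comm (ε⁻¹ ^ (n + 1))]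
    refine mul_le_mul_of_nonneg_right ?_ (by positivity)
    refine (mul_le_mul hCinv (auxPsi_bound n (ε⁻¹ * x)) (abs_nonneg _) (by positivity)).trans ?_
    unfold mollifierBound
    have p1 : (8 : ℝ) ^ n ≤ 64 ^ n := pow_le_pow_left₀ (by norm_num) (by norm_num) n
    have p2 : (n : ℝ) ^ (2 * n) ≤ ((n + 1 : ℕ) : ℝ) ^ (2 * (n + 1) + 2) := by
      refine (pow_le_pow_left₀ (by positivity) (show (n : ℝ) ≤ ((n + 1 : ℕ) : ℝ) by
        push_cast; linarith) _).trans ?_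
      exact pow_le_pow_right₀ (by push_cast; linarith [Nat.cast_nonneg (α := ℝ) n]) (by omega)
    calc 128 * Real.exp 1 * (8 ^ n * ((n + 1).factorial : ℝ) * (n : ℝ) ^ (2 * n))
        ≤ 128 * Real.exp 1 * (64 ^ n * ((n + 1).factorial : ℝ) *
          ((n + 1 : ℕ) : ℝ) ^ (2 * (n + 1) + 2)) := by gcongr
      _ = _ := by ring
end

section
/- Let d be a positive integer, let σ ∈ {−1,1}^d, and let O_σ := {X ∈ ℝ^d : σ_i X_i > 0 for all i ∈ [d]} be the corresponding open orthant. For every ε > 0 there exists an infinitely differentiable function Ψ : ℝ^d → [0,1] such that: (1) Ψ(X) = 0 for all X ∉ O_σ; (2) Ψ(X) = 1 for all X ∈ O_σ with min_i |X_i| ≥ ε; (3) for every multi-index J ∈ ℕ^d with |J| = k ≥ 1, the iterated partial derivative ∂^J Ψ := ∂^{J_1}_{x_1} ⋯ ∂^{J_d}_{x_d} Ψ satisfies sup_{X ∈ ℝ^d} |∂^J Ψ(X)| ≤ α(k) · (1/ε)^k; and (4) for every multi-index J ∈ ℕ^d and every X ∈ ℝ^d, ∂^J Ψ(X) ≠ 0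 only if X ∈ O_σ and |X_i| ≤ ε for every i with J_i ≠ 0. -/
/-- The partial derivative ∂_{x_i} of a function on ℝ^d. -/
noncomputable def partialDeriv {d : ℕ} (i : Fin d) (f : (Fin d → ℝ) → ℝ) :
    (Fin d → ℝ) → ℝ :=
  fun x => fderiv ℝ f x (Pi.single i 1)

/-- The multi-index iterated partial derivative ∂^J = ∂^{J_1}_{x_1} ⋯ ∂^{J_d}_{x_d}. -/
noncomputable def multiDeriv {d : ℕ} (J : Fin d → ℕ) (f : (Fin d → ℝ) → ℝ) :
    (Fin d → ℝ) → ℝ :=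
  (List.finRange d).foldr (fun i g => (partialDeriv i)^[J i] g) f


namespace Moll

noncomputable def bb (x : ℝ) : ℝ := expNegInvGlue (8 * x) * expNegInvGlue (8 * (1 - x))

noncomputable def BB (z : ℂ) : ℂ := Complex.exp (-(8 * z)⁻¹ - (8 * (1 - z))⁻¹)

lemma bb_contDiff : ContDiff ℝ (⊤ : ℕ∞) bb := by
  unfold bb
  exact (expNegInvGlue.contDiff.comp (by fun_prop)).mul (expNegInvGlue.contDiff.comp (by fun_prop))

lemma bb_nonneg (x : ℝ) : 0 ≤ bb x :=
  mul_nonneg (expNegInvGlue.nonneg _) (expNegInvGlue.nonneg _)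

lemma bb_left {x : ℝ} (hx : x ≤ 0) : bb x = 0 := by
  unfold bb; rw [expNegInvGlue.zero_of_nonpos (by linarith), zero_mul]

lemma bb_right {x : ℝ} (hx : 1 ≤ x) : bb x = 0 := by
  unfold bb; rw [expNegInvGlue.zero_of_nonpos (x := 8 * (1 - x)) (by linarith), mul_zero]

lemma BB_diff {z : ℂ} (h0 : 0 < z.re) (h1 : z.re < 1) : DifferentiableAt ℂ BB z := by
  have hz : (8 * z) ≠ 0 := by
    intro h
    have := congrArg Complex.re h
    simp at this; linarith
  have hz1 : (8 * (1 - z)) ≠ 0 := by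
    intro h
    have := congrArg Complex.re h
    simp at this; linarith
  unfold BB
  fun_prop (disch := assumption)

lemma strip_open : IsOpen {z : ℂ | 0 < z.re ∧ z.re < 1} :=
  (isOpen_lt continuous_const Complex.continuous_re).inter
    (isOpen_lt Complex.continuous_re continuous_const)

lemma BB_an {z : ℂ} (h0 : 0 < z.re) (h1 : z.re < 1) : AnalyticAt ℂ BB z :=
  DifferentiableOn.analyticAt (s := {z : ℂ | 0 < z.re ∧ z.re < 1})
    (fun w hw => (BB_diff hw.1 hw.2).differentiableWithinAt)
    (strip_open.mem_nhds ⟨h0, h1⟩)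

lemma BB_real {x : ℝ} (h0 : 0 < x) (h1 : x < 1) : BB x = (bb x : ℂ) := by
  have a1 : ¬ (8 * x ≤ 0) := by linarith
  have a2 : ¬ (8 * (1 - x) ≤ 0) := by linarith
  unfold BB bb expNegInvGlue
  rw [if_neg a1, if_neg a2, ← Real.exp_add]
  push_cast
  rw [sub_eq_add_neg]

lemma iter_real (n : ℕ) : ∀ x : ℝ, 0 < x → x < 1 →
    iteratedDeriv n BB x = ((iteratedDeriv n bb x : ℝ) : ℂ) := by
  induction n with
  | zero => intro x h0 h1; simpa using BB_real h0 h1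
  | succ n ih =>
    intro x h0 h1
    have hA : DifferentiableAt ℂ (iteratedDeriv n BB) x := by
      have := (BB_an (z := (x : ℂ)) (by simpa using h0) (by simpa using h1)).iterated_deriv n
      rw [← iteratedDeriv_eq_iterate] at this
      exact this.differentiableAt
    have h2 := hA.hasDerivAt.comp_ofReal
    have hB : DifferentiableAt ℝ (iteratedDeriv n bb) x :=
      (bb_contDiff.differentiable_iteratedDeriv n (by exact_mod_cast ENat.coe_lt_top n)) x
    have h3 := hB.hasDerivAt.ofReal_comp
    have h4 : (fun y : ℝ => ((iteratedDeriv n bb y : ℝ) : ℂ)) =ᶠ[nhds x]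
        fun y : ℝ => iteratedDeriv n BB y := by
      filter_upwards [Ioo_mem_nhds h0 h1] with y hy
      exact (ih y hy.1 hy.2).symm
    have h5 := h3.congr_of_eventuallyEq h4.symm
    rw [iteratedDeriv_succ, iteratedDeriv_succ]
    exact h2.unique h5

lemma re_inv_bound {x r : ℝ} (hx : 0 < x) (hr : 0 < r) (hrx : r ≤ x / 2) {z : ℂ}
    (hz : ‖z - x‖ = r) : 1 / (12 * x) ≤ ((8 * z)⁻¹).re := by
  have h1 : (z.re - x) ^ 2 + z.im ^ 2 = r ^ 2 := by
    rw [← hz, ← Complex.normSq_eq_norm_sq, Complex.normSq_apply]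
    simp; ring
  have h2 : z.re - x ≤ r := abs_le_of_sq_le_sq' (by nlinarith [sq_nonneg z.im]) hr.le |>.2
  have h3 : -r ≤ z.re - x := abs_le_of_sq_le_sq' (by nlinarith [sq_nonneg z.im]) hr.le |>.1
  have hre : 0 < z.re := by linarith
  have hn : 0 < z.re ^ 2 + z.im ^ 2 := by positivity
  have : ((8 * z)⁻¹).re = z.re / (8 * (z.re ^ 2 + z.im ^ 2)) := by
    rw [Complex.inv_re, Complex.normSq_apply]
    simp
    field_simp
  rw [this, div_le_div_iff₀ (by positivity) (by positivity)]
  nlinarith [mul_le_mul_of_nonneg_left h2 hx.le, mul_le_mul_of_nonneg_left hrx hx.le,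
    mul_le_mul hrx hrx hr.le (by linarith)]

lemma bb_iter_bound_aux (n : ℕ) {x m : ℝ} (h0 : 0 < m) (hx : m ≤ x) (hx1 : m ≤ 1 - x)
    (hm : m = x ∨ m = 1 - x) :
    |iteratedDeriv n bb x| ≤ (n.factorial : ℝ) ^ 2 * 24 ^ n := by
  have hr : 0 < m / 2 := by linarith
  have key := Complex.norm_iteratedDeriv_le_of_forall_mem_sphere_norm_le (c := (x : ℂ))
    (R := m / 2) (C := Real.exp (-(1 / (12 * m)))) (f := BB) n hr ?_ ?_
  · rw [iter_real n x (by linarith) (by linarith), Complex.norm_real, Real.norm_eq_abs] at key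
    refine key.trans ?_
    have hp := Real.pow_div_factorial_le_exp (x := 1 / (12 * m)) (by positivity) n
    have hf : (0 : ℝ) < n.factorial := by positivity
    rw [Real.exp_neg, div_le_iff₀ (by positivity), mul_inv_le_iff₀ (Real.exp_pos _)]
    have e : (n.factorial : ℝ) ^ 2 * 24 ^ n * (m / 2) ^ n * ((1 / (12 * m)) ^ n / n.factorial)
        = n.factorial := by
      have : (24 : ℝ) ^ n * (m / 2) ^ n * (1 / (12 * m)) ^ n = 1 := by
        rw [← mul_pow, ← mul_pow]
        convert one_pow n
        field_simp
        norm_num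
      field_simp at this ⊢
      linear_combination this
    calc (n.factorial : ℝ) = _ := e.symm
      _ ≤ _ := by gcongr
  · apply DifferentiableOn.diffContOnCl
    intro z hz
    rw [closure_ball _ hr.ne', Metric.mem_closedBall, dist_eq_norm] at hz
    have := (Complex.abs_re_le_norm _).trans hz
    simp at this
    rw [abs_le] at this
    exact (BB_diff (by linarith) (by linarith)).differentiableWithinAt
  · intro z hz
    rw [Metric.mem_sphere, dist_eq_norm] at hz
    have b1 := re_inv_bound (x := x) (by linarith) hr (by linarith) hz
    have b2 := re_inv_bound (x := 1 - x) (r := m / 2) (z := 1 - z) (by linarith) hr (by linarith)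
      (by rw [← hz, ← norm_neg]; congr 1; push_cast; ring)
    unfold BB
    rw [Complex.norm_exp]
    apply Real.exp_le_exp.2
    rw [Complex.sub_re, Complex.neg_re]
    have p1 : 0 < 1 / (12 * x) := by have : 0 < x := by linarith
                                     positivity
    have p2 : 0 < 1 / (12 * (1 - x)) := by have : 0 < 1 - x := by linarith
                                           positivity
    rcases hm with rfl | rfl <;> linarith

lemma iter_left (f : ℝ → ℝ) (hf : ContDiff ℝ (⊤ : ℕ∞) f) (h : ∀ x ≤ 0, f x = 0) (n : ℕ) {x : ℝ}
    (hx : x ≤ 0) : iteratedDeriv n f x = 0 := by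
  have hc : IsClosed {x | iteratedDeriv n f x = 0} :=
    isClosed_eq (hf.continuous_iteratedDeriv n (by exact_mod_cast le_top)) continuous_const
  have hs : Set.Iio (0 : ℝ) ⊆ {x | iteratedDeriv n f x = 0} := by
    intro y hy
    have : f =ᶠ[nhds y] fun _ => 0 := by
      filter_upwards [Iio_mem_nhds hy] with z hz using h z (le_of_lt hz)
    have h2 := this.iteratedDeriv_eq n
    simp at h2
    exact h2
  have := closure_minimal hs hc
  rw [closure_Iio] at this
  exact this hx

lemma iter_right (f : ℝ → ℝ) (hf : ContDiff ℝ (⊤ : ℕ∞) f) (c : ℝ) (h : ∀ x, 1 ≤ x → f x = c)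
    (n : ℕ) (hn : n ≠ 0) {x : ℝ} (hx : 1 ≤ x) : iteratedDeriv n f x = 0 := by
  have hc : IsClosed {x | iteratedDeriv n f x = 0} :=
    isClosed_eq (hf.continuous_iteratedDeriv n (by exact_mod_cast le_top)) continuous_const
  have hs : Set.Ioi (1 : ℝ) ⊆ {x | iteratedDeriv n f x = 0} := by
    intro y hy
    have : f =ᶠ[nhds y] fun _ => c := by
      filter_upwards [Ioi_mem_nhds hy] with z hz using h z (le_of_lt hz)
    have h2 := this.iteratedDeriv_eq n
    simp [iteratedDeriv_const, hn] at h2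
    exact h2
  have := closure_minimal hs hc
  rw [closure_Ioi] at this
  exact this hx

lemma bb_iter_bound (n : ℕ) (x : ℝ) (h0 : 0 < x) (h1 : x < 1) :
    |iteratedDeriv n bb x| ≤ (n.factorial : ℝ) ^ 2 * 24 ^ n := by
  rcases le_total x (1 - x) with h | h
  · exact bb_iter_bound_aux n h0 le_rfl h (Or.inl rfl)
  · exact bb_iter_bound_aux n (m := 1 - x) (by linarith) h le_rfl (Or.inr rfl)

lemma bb_int (a b : ℝ) : IntervalIntegrable bb MeasureTheory.volume a b :=
  bb_contDiff.continuous.intervalIntegrable a b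

lemma c_bound : (1 : ℝ) / 64 ≤ ∫ x in (0:ℝ)..1, bb x := by
  have h1 : ∫ x in (1/4:ℝ)..(3/4), bb x ≤ ∫ x in (0:ℝ)..1, bb x := by
    apply intervalIntegral.integral_mono_interval (by norm_num) (by norm_num) (by norm_num)
    · exact Filter.Eventually.of_forall bb_nonneg
    · exact bb_int _ _
  have h2 : ∫ x in (1/4:ℝ)..(3/4), Real.exp (-1) ≤ ∫ x in (1/4:ℝ)..(3/4), bb x := by
    apply intervalIntegral.integral_mono_on (by norm_num) (by simp) (bb_int _ _)
    intro x hx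
    have e : expNegInvGlue 2 = Real.exp (-2⁻¹) := by unfold expNegInvGlue; rw [if_neg (by norm_num)]
    have a1 : Real.exp (-2⁻¹) ≤ expNegInvGlue (8 * x) := by
      rw [← e]; exact expNegInvGlue.monotone (by linarith [hx.1])
    have a2 : Real.exp (-2⁻¹) ≤ expNegInvGlue (8 * (1 - x)) := by
      rw [← e]; exact expNegInvGlue.monotone (by linarith [hx.2])
    calc Real.exp (-1) = Real.exp (-2⁻¹) * Real.exp (-2⁻¹) := by
          rw [← Real.exp_add]; norm_num
      _ ≤ _ := mul_le_mul a1 a2 (Real.exp_pos _).le (expNegInvGlue.nonneg _)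
  rw [intervalIntegral.integral_const, smul_eq_mul] at h2
  have h3 : 1 / 3 ≤ Real.exp (-1) := by
    rw [Real.exp_neg, ← one_div]
    exact one_div_le_one_div_of_le (Real.exp_pos _) (by linarith [Real.exp_one_lt_d9])
  linarith

noncomputable def psi (x : ℝ) : ℝ := (∫ t in (0:ℝ)..1, bb t)⁻¹ * ∫ t in (0:ℝ)..x, bb t

lemma psi_deriv (x : ℝ) : HasDerivAt psi ((∫ t in (0:ℝ)..1, bb t)⁻¹ * bb x) x :=
  (intervalIntegral.integral_hasDerivAt_right (bb_int _ _)
    bb_contDiff.continuous.aestronglyMeasurable.stronglyMeasurableAtFilter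
    bb_contDiff.continuous.continuousAt).const_mul _

lemma psi_deriv' : deriv psi = fun x => (∫ t in (0:ℝ)..1, bb t)⁻¹ * bb x :=
  funext fun x => (psi_deriv x).deriv

lemma psi_contDiff : ContDiff ℝ (⊤ : ℕ∞) psi := by
  rw [contDiff_infty_iff_deriv, psi_deriv']
  exact ⟨fun x => (psi_deriv x).differentiableAt, contDiff_const.mul bb_contDiff⟩

lemma psi_left {x : ℝ} (hx : x ≤ 0) : psi x = 0 := by
  unfold psi
  rw [intervalIntegral.integral_symm x 0,
    intervalIntegral.integral_congr (a := x) (b := 0) (g := fun _ => 0)]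
  · simp
  · intro y hy
    rw [Set.uIcc_of_le hx] at hy
    exact bb_left hy.2

lemma psi_right {x : ℝ} (hx : 1 ≤ x) : psi x = 1 := by
  have hc := c_bound
  unfold psi
  rw [← intervalIntegral.integral_add_adjacent_intervals (bb_int 0 1) (bb_int 1 x),
    intervalIntegral.integral_congr (a := 1) (b := x) (g := fun _ => 0)]
  · simp
    exact inv_mul_cancel₀ (by linarith)
  · intro y hy
    rw [Set.uIcc_of_le hx] at hy
    exact bb_right hy.1

lemma psi_mono : Monotone psi := by
  apply monotone_of_deriv_nonneg (fun x => (psi_deriv x).differentiableAt)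
  intro x
  rw [psi_deriv']
  have hc := c_bound
  exact mul_nonneg (inv_nonneg.2 (by linarith)) (bb_nonneg x)

lemma psi_mem (x : ℝ) : psi x ∈ Set.Icc (0:ℝ) 1 := by
  constructor
  · rcases le_total x 0 with h | h
    · rw [psi_left h]
    · rw [← psi_left (le_refl 0)]; exact psi_mono h
  · rcases le_total x 1 with h | h
    · rw [← psi_right (le_refl 1)]; exact psi_mono h
    · rw [psi_right h]

lemma psi_bound (k : ℕ) (x : ℝ) :
    |iteratedDeriv k psi x| ≤ 64 ^ k * (k.factorial : ℝ) ^ 2 := by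
  rcases k with _ | n
  · have := psi_mem x
    simp
    rw [abs_le]; constructor <;> linarith [this.1, this.2]
  · rcases le_or_gt x 0 with h0 | h0
    · rw [iter_left psi psi_contDiff (fun x h => psi_left h) _ h0]; simp
    rcases le_or_gt 1 x with h1 | h1
    · rw [iter_right psi psi_contDiff 1 (fun x h => psi_right h) _ (by simp) h1]; simp
    rw [iteratedDeriv_succ', psi_deriv', iteratedDeriv_const_mul_field, abs_mul]
    have hc := c_bound
    have hc' : |(∫ t in (0:ℝ)..1, bb t)⁻¹| ≤ 64 := by
      rw [abs_of_nonneg (inv_nonneg.2 (by linarith))]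
      calc _ ≤ ((1:ℝ) / 64)⁻¹ := inv_anti₀ (by norm_num) hc
        _ = 64 := by norm_num
    calc _ ≤ 64 * ((n.factorial : ℝ) ^ 2 * 24 ^ n) :=
          mul_le_mul hc' (bb_iter_bound n x h0 h1) (abs_nonneg _) (by norm_num)
      _ ≤ 64 * (((n+1).factorial : ℝ) ^ 2 * 64 ^ n) := by
          gcongr
          · omega
          · norm_num
      _ = _ := by ring

/-! Product structure -/

lemma pd_prod {d : ℕ} (g : Fin d → ℝ → ℝ) (hg : ∀ i, Differentiable ℝ (g i)) (i : Fin d) :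
    partialDeriv i (fun X => ∏ j, g j (X j)) =
      fun X => ∏ j, (Function.update g i (deriv (g i))) j (X j) := by
  funext X
  unfold partialDeriv
  have hd : DifferentiableAt ℝ (fun X : Fin d → ℝ => ∏ j, g j (X j)) X := by
    have : ∀ j, Differentiable ℝ (fun X : Fin d → ℝ => g j (X j)) :=
      fun j => (hg j).comp (differentiable_apply j)
    fun_prop
  have h1 : HasDerivAt (fun t : ℝ => Function.update X i t) (Pi.single i 1) (X i) :=
    hasDerivAt_update X i (X i)
  have h2 : HasDerivAt (fun t : ℝ => ∏ j, g j (Function.update X i t j))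
      (fderiv ℝ (fun X : Fin d → ℝ => ∏ j, g j (X j)) X (Pi.single i 1)) (X i) := by
    have := HasFDerivAt.comp_hasDerivAt (X i) (f := fun t : ℝ => Function.update X i t)
      (l := fun X : Fin d → ℝ => ∏ j, g j (X j)) (by
        simpa using hd.hasFDerivAt) h1
    exact this
  have h3 : (fun t : ℝ => ∏ j, g j (Function.update X i t j)) =
      fun t => g i t * ∏ j ∈ Finset.univ.erase i, g j (X j) := by
    funext t
    rw [← Finset.mul_prod_erase _ _ (Finset.mem_univ i)]
    simp only [Function.update_self]
    congr 1
    apply Finset.prod_congr rfl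
    intro j hj
    rw [Function.update_of_ne (Finset.ne_of_mem_erase hj)]
  rw [h3] at h2
  rw [h2.unique (((hg i (X i)).hasDerivAt).mul_const _)]
  rw [← Finset.mul_prod_erase _ _ (Finset.mem_univ i), Function.update_self]
  congr 1
  apply Finset.prod_congr rfl
  intro j hj
  rw [Function.update_of_ne (Finset.ne_of_mem_erase hj)]

lemma pd_iter {d : ℕ} (g : Fin d → ℝ → ℝ) (hg : ∀ i, ContDiff ℝ (⊤ : ℕ∞) (g i)) (i : Fin d)
    (n : ℕ) : (partialDeriv i)^[n] (fun X => ∏ j, g j (X j)) =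
      fun X => ∏ j, (Function.update g i (iteratedDeriv n (g i))) j (X j) := by
  induction n with
  | zero => simp
  | succ n ih =>
    rw [Function.iterate_succ_apply', ih, pd_prod]
    · simp [iteratedDeriv_succ]
    · intro j
      by_cases h : j = i
      · subst h
        rw [Function.update_self]
        exact (hg j).differentiable_iteratedDeriv n (by exact_mod_cast ENat.coe_lt_top n)
      · rw [Function.update_of_ne h]
        exact (hg j).differentiable (by simp)

lemma iter_contDiff (f : ℝ → ℝ) (hf : ContDiff ℝ (⊤ : ℕ∞) f) (n : ℕ) :
    ContDiff ℝ (⊤ : ℕ∞) (iteratedDeriv n f) := by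
  induction n with
  | zero => simpa using hf
  | succ n ih => rw [iteratedDeriv_succ]; exact (contDiff_infty_iff_deriv.1 ih).2

lemma fold_prod {d : ℕ} (g : Fin d → ℝ → ℝ) (hg : ∀ i, ContDiff ℝ (⊤ : ℕ∞) (g i))
    (J : Fin d → ℕ) (l : List (Fin d)) (hl : l.Nodup) :
    l.foldr (fun i f => (partialDeriv i)^[J i] f) (fun X => ∏ j, g j (X j)) =
      fun X => ∏ j, (if j ∈ l then iteratedDeriv (J j) (g j) else g j) (X j) := by
  induction l with
  | nil => simp
  | cons a l ih =>
    rw [List.nodup_cons] at hl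
    rw [List.foldr_cons, ih hl.2, pd_iter (fun j => if j ∈ l then iteratedDeriv (J j) (g j) else g j)]
    · funext X
      apply Finset.prod_congr rfl
      intro j _
      by_cases h : j = a
      · subst h; simp [hl.1]
      · simp [Function.update_of_ne h, h]
    · intro j
      split_ifs
      · exact iter_contDiff _ (hg j) _
      · exact hg j

lemma multi_prod {d : ℕ} (g : Fin d → ℝ → ℝ) (hg : ∀ i, ContDiff ℝ (⊤ : ℕ∞) (g i))
    (J : Fin d → ℕ) : multiDeriv J (fun X => ∏ j, g j (X j)) =
      fun X => ∏ j, iteratedDeriv (J j) (g j) (X j) := by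
  unfold multiDeriv
  rw [fold_prod g hg J _ (List.nodup_finRange d)]
  simp

lemma final_bound {d : ℕ} (J : Fin d → ℕ) (h : 1 ≤ ∑ i, J i) :
    ∏ i, ((64:ℝ) ^ J i * ((J i).factorial : ℝ) ^ 2) ≤ mollifierBound (∑ i, J i) := by
  rw [Finset.prod_mul_distrib, Finset.prod_pow_eq_pow_sum, Finset.prod_pow]
  have h1 : (∏ i, ((J i).factorial : ℝ)) ≤ ((∑ i, J i).factorial : ℝ) := by
    exact_mod_cast Nat.le_of_dvd (Nat.factorial_pos _) (Nat.prod_factorial_dvd_factorial_sum _ _)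
  generalize ∑ i, J i = k at *
  have h0 : (0:ℝ) ≤ ∏ i, ((J i).factorial : ℝ) := by positivity
  have hk : (k.factorial : ℝ) ≤ (k : ℝ) ^ (2 * k + 2) := by
    have : k.factorial ≤ k ^ (2 * k + 2) :=
      (Nat.factorial_le_pow k).trans (Nat.pow_le_pow_right h (by omega))
    exact_mod_cast this
  unfold mollifierBound
  have he : 1 ≤ 2 * Real.exp 1 := by linarith [Real.add_one_le_exp (1:ℝ)]
  calc _ ≤ (64:ℝ) ^ k * (k.factorial : ℝ) ^ 2 := by gcongr
    _ = 1 * 64 ^ k * k.factorial * k.factorial := by ring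
    _ ≤ _ := by gcongr

end Moll

open Moll in
/-- Mollifier for a single open orthant O_σ = {X : ∀ i, σ_i X_i > 0} of ℝ^d. -/
theorem stmt11 (d : ℕ) (hd : 0 < d) (σ : Fin d → ℝ) (hσ : ∀ i, σ i = 1 ∨ σ i = -1)
    (ε : ℝ) (hε : 0 < ε) :
    ∃ Ψ : (Fin d → ℝ) → ℝ, ContDiff ℝ (⊤ : ℕ∞) Ψ ∧ (∀ X, Ψ X ∈ Set.Icc (0 : ℝ) 1) ∧
      (∀ X : Fin d → ℝ, ¬ (∀ i, 0 < σ i * X i) → Ψ X = 0) ∧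
      (∀ X : Fin d → ℝ, (∀ i, 0 < σ i * X i) → (∀ i, ε ≤ |X i|) → Ψ X = 1) ∧
      (∀ J : Fin d → ℕ, 1 ≤ ∑ i, J i → ∀ X : Fin d → ℝ,
        |multiDeriv J Ψ X| ≤ mollifierBound (∑ i, J i) * (1 / ε) ^ (∑ i, J i)) ∧
      (∀ J : Fin d → ℕ, ∀ X : Fin d → ℝ, multiDeriv J Ψ X ≠ 0 →
        (∀ i, 0 < σ i * X i) ∧ (∀ i, J i ≠ 0 → |X i| ≤ ε)) := by
  have hg : ∀ i, ContDiff ℝ (⊤ : ℕ∞) (fun t : ℝ => psi (σ i / ε * t)) := fun i =>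
    psi_contDiff.comp (by fun_prop)
  have hmul : ∀ i (X : Fin d → ℝ), σ i / ε * X i = σ i * X i / ε := fun i X => by ring
  have hit : ∀ i n (t : ℝ), iteratedDeriv n (fun t : ℝ => psi (σ i / ε * t)) t =
      (σ i / ε) ^ n * iteratedDeriv n psi (σ i / ε * t) := fun i n t => by
    rw [iteratedDeriv_comp_const_mul (psi_contDiff.of_le (by exact_mod_cast le_top))]
  have habs : ∀ i (X : Fin d → ℝ), 0 < σ i * X i → |X i| = σ i * X i := fun i X h => by
    have : |σ i| = 1 := by rcases hσ i with h | h <;> simp [h]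
    rw [← abs_of_pos h, abs_mul, this, one_mul]
  have hσε : ∀ i, |σ i / ε| = 1 / ε := fun i => by
    have : |σ i| = 1 := by rcases hσ i with h | h <;> simp [h]
    rw [abs_div, this, abs_of_pos hε]
  refine ⟨fun X => ∏ i, (fun t : ℝ => psi (σ i / ε * t)) (X i), ?_, ?_, ?_, ?_, ?_, ?_⟩
  · apply contDiff_prod
    intro i _
    exact (hg i).comp (contDiff_apply ℝ ℝ i)
  · intro X
    exact ⟨Finset.prod_nonneg fun i _ => (psi_mem _).1,
      Finset.prod_le_one (fun i _ => (psi_mem _).1) fun i _ => (psi_mem _).2⟩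
  · intro X hX
    push Not at hX
    obtain ⟨i, hi⟩ := hX
    apply Finset.prod_eq_zero (Finset.mem_univ i)
    apply psi_left
    rw [hmul]
    exact div_nonpos_of_nonpos_of_nonneg hi hε.le
  · intro X hX hX2
    apply Finset.prod_eq_one
    intro i _
    apply psi_right
    rw [hmul, le_div_iff₀ hε, one_mul, ← habs i X (hX i)]
    exact hX2 i
  · intro J hJ X
    rw [multi_prod (fun i t => psi (σ i / ε * t)) hg J, Finset.abs_prod]
    calc _ ≤ ∏ i, ((1 / ε) ^ J i * ((64:ℝ) ^ J i * ((J i).factorial : ℝ) ^ 2)) := by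
          apply Finset.prod_le_prod (fun i _ => abs_nonneg _)
          intro i _
          rw [hit, abs_mul, abs_pow, hσε]
          exact mul_le_mul_of_nonneg_left (psi_bound _ _) (by positivity)
      _ = (∏ i, ((64:ℝ) ^ J i * ((J i).factorial : ℝ) ^ 2)) * (1 / ε) ^ (∑ i, J i) := by
          rw [Finset.prod_mul_distrib, Finset.prod_pow_eq_pow_sum, mul_comm]
      _ ≤ _ := mul_le_mul_of_nonneg_right (final_bound J hJ) (by positivity)
  · intro J X h
    rw [multi_prod (fun i t => psi (σ i / ε * t)) hg J] at h
    have h2 : ∀ i, iteratedDeriv (J i) psi (σ i * X i / ε) ≠ 0 := fun i h0 => by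
      apply h
      apply Finset.prod_eq_zero (Finset.mem_univ i)
      rw [hit, hmul, h0, mul_zero]
    have h3 : ∀ i, 0 < σ i * X i := fun i => by
      by_contra hc
      exact h2 i (iter_left psi psi_contDiff (fun x h => psi_left h) _
        (div_nonpos_of_nonpos_of_nonneg (not_lt.1 hc) hε.le))
    refine ⟨h3, fun i hi => ?_⟩
    by_contra hc
    rw [habs i X (h3 i)] at hc
    exact h2 i (iter_right psi psi_contDiff 1 (fun x h => psi_right h) _ hi
      ((le_div_iff₀ hε).2 (by linarith)))
end
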